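/- Trajectory-level MDL generalization bound. Fix integers K ≥ 2, L ≥ 1, T ≥ 1, m ≥ 1 and a real δ ∈ (0, 1). Let Q be a probability measure on the countable set S_T of nonempty finite sequences over Σ of length at most T (with the discrete σ-algebra), let Q^{⊗m} be the corresponding m-fold product measure on S_T^m, and let Ĉ : S_T^m → 𝒜 be any function selecting an admissible dictionary from the sample. Then the Q^{⊗m}-probability of the set of samples S = (s_1, …, s_m) for which E_{s ∼ Q}[ ℓ̃_m(s, Ĉ(S)) ] > (1/m)·Σ_{i=1}^{m} ℓ̃_m(s_i, Ĉ(S)) + sqrt( (L_dict(Ĉ(S))·ln 2 + ln(m/δ)) / (2m) ) is at most δ. -/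

import Mathlib

open Finset

/-- `seg C s`: the minimum number of phrases from the dictionary `C` whose
concatenation is `s`. -/
noncomputable def seg {α : Type*} (C : Finset (List α)) (s : List α) : ℕ :=
  sInf {n : ℕ | ∃ l : List (List α), (∀ p ∈ l, p ∈ C) ∧ l.flatten = s ∧ l.length = n}

/-- The finite set of all phrases over `Σ = Fin K`: nonempty lists of length at most `L`. -/
def phrases (K L : ℕ) : Finset (List (Fin K)) :=
  ((Finset.range (L + 1)).biUnion fun ℓ =>
    (Finset.univ : Finset (Fin ℓ → Fin K)).image List.ofFn).filter fun p => p ≠ []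

/-- The set `𝒜` of admissible dictionaries: subsets of the set of phrases containing
all `K` singleton phrases. -/
def admissible (K L : ℕ) : Finset (Finset (List (Fin K))) :=
  (phrases K L).powerset.filter fun C => ∀ a : Fin K, [a] ∈ C

/-- The dictionary cost `L_dict(C) = Σ_{p ∈ C} (|p|·log₂ K + log₂ L)`. -/
noncomputable def Ldict (K L : ℕ) (C : Finset (List (Fin K))) : ℝ :=
  ∑ p ∈ C, ((p.length : ℝ) * Real.logb 2 (K : ℝ) + Real.logb 2 (L : ℝ))

/-- The normalized per-sequence MDL loss
`ℓ̃_m(s, C) = (L_dict(C)/m + seg(s, C)·log₂|C|) / (L_dict(C)/m + T·log₂|C|)`. -/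
noncomputable def ellTilde (K L T m : ℕ) (C : Finset (List (Fin K)))
    (s : List (Fin K)) : ℝ :=
  (Ldict K L C / (m : ℝ) + (seg C s : ℝ) * Real.logb 2 (C.card : ℝ)) /
    (Ldict K L C / (m : ℝ) + (T : ℝ) * Real.logb 2 (C.card : ℝ))

open MeasureTheory

/-- `S_T`: the countable set of nonempty finite sequences over `Σ = Fin K` of length
at most `T`. -/
def SeqT (K T : ℕ) : Type := {s : List (Fin K) // s ≠ [] ∧ s.length ≤ T}

/-- Discrete σ-algebra on `S_T`. -/
instance (K T : ℕ) : MeasurableSpace (SeqT K T) := ⊤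

/-- The code weight `K^{-|p|} / L` of a phrase. -/
noncomputable def phraseWeight (K L : ℕ) (p : List (Fin K)) : ℝ :=
  ((K : ℝ) ^ p.length * L)⁻¹

lemma phraseWeight_nonneg (K L : ℕ) (p : List (Fin K)) : 0 ≤ phraseWeight K L p := by
  unfold phraseWeight; positivity

lemma length_mem_Icc_of_mem_phrases {K L : ℕ} {p : List (Fin K)} (hp : p ∈ phrases K L) :
    p.length ∈ Finset.Icc 1 L := by
  simp only [phrases, Finset.mem_filter, Finset.mem_biUnion, Finset.mem_range,
    Finset.mem_image, Finset.mem_univ, true_and] at hp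
  obtain ⟨⟨ℓ, hℓ, g, rfl⟩, hne⟩ := hp
  have := List.length_pos_iff.2 hne
  simp only [List.length_ofFn] at this
  simp only [Finset.mem_Icc, List.length_ofFn]
  omega

lemma card_phrases_filter_length_le (K L ℓ : ℕ) :
    ((phrases K L).filter fun p => p.length = ℓ).card ≤ K ^ ℓ := by
  calc ((phrases K L).filter fun p => p.length = ℓ).card
      ≤ ((Finset.univ : Finset (Fin ℓ → Fin K)).image List.ofFn).card := by
        refine Finset.card_le_card fun p hp => ?_
        obtain ⟨-, rfl⟩ := Finset.mem_filter.1 hp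
        exact Finset.mem_image.2 ⟨p.get, Finset.mem_univ _, List.ofFn_get p⟩
    _ ≤ (Finset.univ : Finset (Fin ℓ → Fin K)).card := Finset.card_image_le
    _ = K ^ ℓ := by simp

lemma sum_phraseWeight_le_one {K L : ℕ} (hK : 2 ≤ K) (hL : 1 ≤ L) :
    ∑ p ∈ phrases K L, phraseWeight K L p ≤ 1 := by
  have hK0 : (0 : ℝ) < K := by exact_mod_cast (by omega : 0 < K)
  have hL0 : (0 : ℝ) < L := by exact_mod_cast hL
  rw [← Finset.sum_fiberwise_of_maps_to (t := Finset.Icc 1 L) (g := List.length)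
    fun p hp => length_mem_Icc_of_mem_phrases hp]
  calc ∑ ℓ ∈ Finset.Icc 1 L, ∑ p ∈ phrases K L with p.length = ℓ, phraseWeight K L p
      ≤ ∑ ℓ ∈ Finset.Icc 1 L, (L : ℝ)⁻¹ := by
        refine Finset.sum_le_sum fun ℓ _ => ?_
        have hw : ∀ p ∈ (phrases K L).filter fun p => p.length = ℓ,
            phraseWeight K L p = ((K : ℝ) ^ ℓ * L)⁻¹ := by
          intro p hp
          rw [phraseWeight, (Finset.mem_filter.1 hp).2]
        rw [Finset.sum_congr rfl hw, Finset.sum_const, nsmul_eq_mul]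
        calc (((phrases K L).filter fun p => p.length = ℓ).card : ℝ) * ((K : ℝ) ^ ℓ * L)⁻¹
            ≤ (K : ℝ) ^ ℓ * ((K : ℝ) ^ ℓ * L)⁻¹ := by
              gcongr
              exact_mod_cast card_phrases_filter_length_le K L ℓ
          _ = (L : ℝ)⁻¹ := by field_simp
    _ = 1 := by
        simp only [Finset.sum_const, Nat.card_Icc, add_tsub_cancel_right, nsmul_eq_mul]
        field_simp

lemma prod_singleton_phraseWeight_le {K L : ℕ} (hK : 2 ≤ K) (hL : 1 ≤ L) :
    ∏ p ∈ (Finset.univ : Finset (Fin K)).image (fun a => [a]), phraseWeight K L p ≤ 1 / 4 := by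
  have hK0 : (2 : ℝ) ≤ K := by exact_mod_cast hK
  have hL0 : (1 : ℝ) ≤ L := by exact_mod_cast hL
  rw [Finset.prod_image (by simp [Set.InjOn])]
  simp only [phraseWeight, List.length_singleton, pow_one, Finset.prod_const, Finset.card_univ,
    Fintype.card_fin]
  have h : ((K : ℝ) * L)⁻¹ ≤ 1 / 2 := by
    rw [one_div]
    exact inv_anti₀ two_pos (by nlinarith)
  calc ((K : ℝ) * L)⁻¹ ^ K ≤ (1 / 2 : ℝ) ^ K := by gcongr
    _ ≤ (1 / 2 : ℝ) ^ 2 := pow_le_pow_of_le_one (by norm_num) (by norm_num) hK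
    _ = 1 / 4 := by norm_num

/-- Kraft-type inequality for admissible dictionaries. -/
lemma sum_admissible_prod_phraseWeight_le_one {K L : ℕ} (hK : 2 ≤ K) (hL : 1 ≤ L) :
    ∑ C ∈ admissible K L, ∏ p ∈ C, phraseWeight K L p ≤ 1 := by
  classical
  set S₁ := (Finset.univ : Finset (Fin K)).image (fun a => [a])
  have hsub : ∀ C ∈ admissible K L, C ⊆ phrases K L ∧ S₁ ⊆ C := by
    intro C hC
    simp only [admissible, Finset.mem_filter, Finset.mem_powerset] at hC
    refine ⟨hC.1, fun p hp => ?_⟩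
    obtain ⟨a, -, rfl⟩ := Finset.mem_image.1 hp
    exact hC.2 a
  have hnn : ∀ C : Finset (List (Fin K)), 0 ≤ ∏ p ∈ C, phraseWeight K L p :=
    fun C => Finset.prod_nonneg fun p _ => phraseWeight_nonneg K L p
  have hinj : Set.InjOn (fun C => C \ S₁) (admissible K L : Set (Finset (List (Fin K)))) := by
    intro C hC D hD h
    rw [← Finset.sdiff_union_of_subset (hsub C hC).2, ← Finset.sdiff_union_of_subset (hsub D hD).2]
    exact congrArg (· ∪ S₁) h
  have hrest : ∑ C ∈ admissible K L, ∏ p ∈ C \ S₁, phraseWeight K L p ≤ Real.exp 1 :=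
    calc ∑ C ∈ admissible K L, ∏ p ∈ C \ S₁, phraseWeight K L p
        = ∑ D ∈ (admissible K L).image (fun C => C \ S₁), ∏ p ∈ D, phraseWeight K L p :=
          (Finset.sum_image (f := fun D => ∏ p ∈ D, phraseWeight K L p) hinj).symm
      _ ≤ ∑ D ∈ (phrases K L).powerset, ∏ p ∈ D, phraseWeight K L p := by
          refine Finset.sum_le_sum_of_subset_of_nonneg (fun D hD => ?_) fun D _ _ => hnn D
          obtain ⟨C, hC, rfl⟩ := Finset.mem_image.1 hD
          exact Finset.mem_powerset.2 (Finset.sdiff_subset.trans (hsub C hC).1)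
      _ = ∏ p ∈ phrases K L, (1 + phraseWeight K L p) := (Finset.prod_one_add _).symm
      _ ≤ Real.exp (∑ p ∈ phrases K L, phraseWeight K L p) :=
          Real.prod_one_add_le_exp_sum _ (phraseWeight_nonneg K L)
      _ ≤ Real.exp 1 := Real.exp_le_exp.2 (sum_phraseWeight_le_one hK hL)
  calc ∑ C ∈ admissible K L, ∏ p ∈ C, phraseWeight K L p
      = (∑ C ∈ admissible K L, ∏ p ∈ C \ S₁, phraseWeight K L p) *
          ∏ p ∈ S₁, phraseWeight K L p := by
        rw [Finset.sum_mul]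
        exact Finset.sum_congr rfl fun C hC => (Finset.prod_sdiff (hsub C hC).2).symm
    _ ≤ Real.exp 1 * (1 / 4) :=
        mul_le_mul hrest (prod_singleton_phraseWeight_le hK hL) (hnn _) (Real.exp_pos _).le
    _ ≤ 1 := by linarith [Real.exp_one_lt_d9]

lemma exp_neg_Ldict_mul_log_two {K L : ℕ} (hK : 2 ≤ K) (hL : 1 ≤ L)
    (C : Finset (List (Fin K))) :
    Real.exp (-(Ldict K L C * Real.log 2)) = ∏ p ∈ C, phraseWeight K L p := by
  have hK0 : (0 : ℝ) < K := by exact_mod_cast (by omega : 0 < K)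
  have hL0 : (0 : ℝ) < L := by exact_mod_cast hL
  have h2 : Real.log 2 ≠ 0 := (Real.log_pos one_lt_two).ne'
  rw [Ldict, Finset.sum_mul, ← Finset.sum_neg_distrib, Real.exp_sum]
  refine Finset.prod_congr rfl fun p _ => ?_
  have h : ((p.length : ℝ) * Real.logb 2 K + Real.logb 2 L) * Real.log 2 =
      Real.log ((K : ℝ) ^ p.length * L) := by
    rw [Real.log_mul (by positivity) hL0.ne', Real.log_pow, Real.logb, Real.logb]
    field_simp
  rw [h, Real.exp_neg, Real.exp_log (by positivity), phraseWeight]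

lemma logb_two_natCast_nonneg (n : ℕ) : 0 ≤ Real.logb 2 (n : ℝ) :=
  div_nonneg (Real.log_natCast_nonneg n) (Real.log_pos one_lt_two).le

lemma Ldict_nonneg (K L : ℕ) (C : Finset (List (Fin K))) : 0 ≤ Ldict K L C :=
  Finset.sum_nonneg fun p _ => add_nonneg
    (mul_nonneg p.length.cast_nonneg (logb_two_natCast_nonneg K)) (logb_two_natCast_nonneg L)

lemma seg_le_length {α : Type*} {C : Finset (List α)} (hC : ∀ a, [a] ∈ C) (s : List α) :
    seg C s ≤ s.length := by
  refine Nat.sInf_le ⟨s.map fun a => [a], ?_, ?_, by simp⟩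
  · intro p hp
    obtain ⟨a, -, rfl⟩ := List.mem_map.1 hp
    exact hC a
  · induction s with
    | nil => rfl
    | cons a s ih => simpa using ih

lemma ellTilde_mem_Icc {K L T : ℕ} (m : ℕ) {C : Finset (List (Fin K))}
    (hC : C ∈ admissible K L) {s : List (Fin K)} (hs : s.length ≤ T) :
    ellTilde K L T m C s ∈ Set.Icc (0 : ℝ) 1 := by
  have hD : 0 ≤ Ldict K L C / (m : ℝ) := div_nonneg (Ldict_nonneg K L C) m.cast_nonneg
  have hlog := logb_two_natCast_nonneg C.card
  have hseg : (seg C s : ℝ) ≤ T := by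
    exact_mod_cast (seg_le_length (Finset.mem_filter.1 hC).2 s).trans hs
  have hle : (seg C s : ℝ) * Real.logb 2 C.card ≤ T * Real.logb 2 C.card := by gcongr
  exact ⟨by unfold ellTilde; positivity,
    div_le_one_of_le₀ (by linarith) (by positivity)⟩

/-- One-sided Hoeffding inequality for the empirical mean of an i.i.d. sample. -/
lemma measure_pi_empiricalMean_add_lt_integral_le {Ω : Type*} [MeasurableSpace Ω]
    (Q : Measure Ω) [IsProbabilityMeasure Q] {m : ℕ} (hm : 1 ≤ m) {f : Ω → ℝ}
    (hf : Measurable f) (hf01 : ∀ s, f s ∈ Set.Icc (0 : ℝ) 1) {ε : ℝ} (hε : 0 ≤ ε) :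
    (Measure.pi fun _ : Fin m => Q)
      {S | (1 / (m : ℝ)) * ∑ i, f (S i) + ε < ∫ s, f s ∂Q} ≤
        ENNReal.ofReal (Real.exp (-(2 * m * ε ^ 2))) := by
  have hm0 : (0 : ℝ) < m := by exact_mod_cast hm
  set X : Fin m → (Fin m → Ω) → ℝ := fun i S => (∫ s, f s ∂Q) - f (S i) with hX
  have hsub : ∀ i ∈ (Finset.univ : Finset (Fin m)), ProbabilityTheory.HasSubgaussianMGF (X i)
      ((‖(0 : ℝ) - -1‖₊ / 2) ^ 2) (Measure.pi fun _ : Fin m => Q) := by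
    intro i _
    have hmean : ∫ S, -f (S i) ∂(Measure.pi fun _ : Fin m => Q) = -∫ s, f s ∂Q := by
      rw [integral_neg]
      congr 1
      have hmp := measurePreserving_eval (fun _ : Fin m => Q) i
      rw [← hmp.map_eq, integral_map hmp.measurable.aemeasurable hf.aestronglyMeasurable]
      simp [hmp.map_eq]
    have h := ProbabilityTheory.hasSubgaussianMGF_of_mem_Icc
      (μ := Measure.pi fun _ : Fin m => Q) (X := fun S => -f (S i)) (a := -1) (b := 0)
      (hf.comp (measurable_pi_apply i)).neg.aemeasurable
      (Filter.Eventually.of_forall fun S => by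
        have := hf01 (S i)
        exact ⟨by linarith [this.2], by linarith [this.1]⟩)
    rw [hmean] at h
    convert h using 2 with S
    simp only [hX]
    ring
  have hind : ProbabilityTheory.iIndepFun X (Measure.pi fun _ : Fin m => Q) :=
    ProbabilityTheory.iIndepFun_pi (X := fun _ s => (∫ s, f s ∂Q) - f s)
      fun _ => (measurable_const.sub hf).aemeasurable
  have hoeffding := ProbabilityTheory.HasSubgaussianMGF.measure_sum_ge_le_of_iIndepFun hind hsub
    (mul_nonneg hm0.le hε)
  calc (Measure.pi fun _ : Fin m => Q) {S | (1 / (m : ℝ)) * ∑ i, f (S i) + ε < ∫ s, f s ∂Q}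
      ≤ (Measure.pi fun _ : Fin m => Q) {S | m * ε ≤ ∑ i, X i S} := by
        refine measure_mono fun S hS => ?_
        simp only [Set.mem_ofPred_eq] at hS
        have hsum : ∑ i, X i S = m * (∫ s, f s ∂Q) - ∑ i, f (S i) := by simp [hX]
        have h := mul_le_mul_of_nonneg_left hS.le hm0.le
        have hcancel : (m : ℝ) * ((1 / (m : ℝ)) * ∑ i, f (S i) + ε) =
            ∑ i, f (S i) + m * ε := by field_simp
        simp only [Set.mem_ofPred_eq]
        linarith
    _ ≤ ENNReal.ofReal (Real.exp (-(2 * m * ε ^ 2))) := by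
        rw [← ofReal_measureReal]
        refine ENNReal.ofReal_le_ofReal (hoeffding.trans_eq ?_)
        congr 1
        simp
        field_simp

/-- **Trajectory-level MDL generalization bound.** For `K ≥ 2`,
`L ≥ 1`, `T ≥ 1`, `m ≥ 1`, `δ ∈ (0,1)`, any probability measure `Q` on `S_T`
(discrete σ-algebra), and any dictionary selector `Ĉ : S_T^m → 𝒜`, the
`Q^{⊗m}`-probability of the event
`E_{s∼Q}[ℓ̃_m(s, Ĉ(S))] > (1/m)·Σ_i ℓ̃_m(s_i, Ĉ(S)) +
  √((L_dict(Ĉ(S))·ln 2 + ln(m/δ)) / (2m))`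
is at most `δ`. -/
theorem mdl_pac_bayes_bound
    (K L T m : ℕ) (hK : 2 ≤ K) (hL : 1 ≤ L) (hT : 1 ≤ T) (hm : 1 ≤ m)
    (δ : ℝ) (hδ0 : 0 < δ) (hδ1 : δ < 1)
    (Q : Measure (SeqT K T)) [IsProbabilityMeasure Q]
    (Chat : (Fin m → SeqT K T) → Finset (List (Fin K)))
    (hChat : ∀ S, Chat S ∈ admissible K L) :
    (Measure.pi fun _ : Fin m => Q)
      {S : Fin m → SeqT K T |
        (1 / (m : ℝ)) * ∑ i : Fin m, ellTilde K L T m (Chat S) (S i).1 +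
            Real.sqrt ((Ldict K L (Chat S) * Real.log 2 + Real.log ((m : ℝ) / δ))
              / (2 * (m : ℝ)))
          < ∫ s, ellTilde K L T m (Chat S) s.1 ∂Q } ≤ ENNReal.ofReal δ := by
  have hm0 : (0 : ℝ) < m := by exact_mod_cast hm
  have hm1 : (1 : ℝ) ≤ m := by exact_mod_cast hm
  set R : Finset (List (Fin K)) → ℝ := fun C =>
    (Ldict K L C * Real.log 2 + Real.log ((m : ℝ) / δ)) / (2 * (m : ℝ)) with hR
  have hR0 : ∀ C, 0 ≤ R C := fun C => by
    have hlog : 0 ≤ Real.log ((m : ℝ) / δ) :=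
      Real.log_nonneg ((one_le_div hδ0).2 (hδ1.le.trans hm1))
    have hcost := mul_nonneg (Ldict_nonneg K L C) (Real.log_pos one_lt_two).le
    exact div_nonneg (add_nonneg hcost hlog) (by positivity)
  set bad : Finset (List (Fin K)) → Set (Fin m → SeqT K T) := fun C =>
    {S | (1 / (m : ℝ)) * ∑ i : Fin m, ellTilde K L T m C (S i).1 + Real.sqrt (R C)
      < ∫ s, ellTilde K L T m C s.1 ∂Q} with hbad
  have hdeviation : ∀ C ∈ admissible K L, (Measure.pi fun _ : Fin m => Q) (bad C) ≤
      ENNReal.ofReal ((∏ p ∈ C, phraseWeight K L p) * (δ / m)) := by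
    intro C hC
    refine (measure_pi_empiricalMean_add_lt_integral_le Q hm
      (f := fun s : SeqT K T => ellTilde K L T m C s.1) measurable_from_top
      (fun s => ellTilde_mem_Icc m hC s.2.2) (Real.sqrt_nonneg (R C))).trans_eq ?_
    have hexponent : -(2 * (m : ℝ) * R C) =
        -(Ldict K L C * Real.log 2) + -Real.log ((m : ℝ) / δ) := by
      simp only [hR]
      field_simp
      ring
    rw [Real.sq_sqrt (hR0 C), hexponent, Real.exp_add, exp_neg_Ldict_mul_log_two hK hL,
      Real.exp_neg, Real.exp_log (by positivity), inv_div]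
  calc (Measure.pi fun _ : Fin m => Q) _
      ≤ (Measure.pi fun _ : Fin m => Q) (⋃ C ∈ admissible K L, bad C) :=
        measure_mono fun S hS => Set.mem_biUnion (hChat S) hS
    _ ≤ ∑ C ∈ admissible K L, (Measure.pi fun _ : Fin m => Q) (bad C) :=
        measure_biUnion_finset_le _ _
    _ ≤ ∑ C ∈ admissible K L, ENNReal.ofReal ((∏ p ∈ C, phraseWeight K L p) * (δ / m)) :=
        Finset.sum_le_sum hdeviation
    _ = ENNReal.ofReal ((∑ C ∈ admissible K L, ∏ p ∈ C, phraseWeight K L p) * (δ / m)) := by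
        rw [Finset.sum_mul, ENNReal.ofReal_sum_of_nonneg]
        exact fun C _ => mul_nonneg
          (Finset.prod_nonneg fun p _ => phraseWeight_nonneg K L p) (by positivity)
    _ ≤ ENNReal.ofReal δ := by
        refine ENNReal.ofReal_le_ofReal ?_
        calc _ ≤ 1 * (δ / m) := by
              gcongr
              exact sum_admissible_prod_phraseWeight_le_one hK hL
          _ ≤ δ := by
              rw [one_mul]
              exact div_le_self hδ0.le hm1
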